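/- Let a and b be nonzero integers with a ≠ −b and gcd(a,b) = 1, let n be a positive integer, and let p be an odd prime with p ∤ ab and p ∣ (a^n + b^n). Then ν_p(a^n + b^n) − ν_p(n) = ν_p(a^(p−1) − b^(p−1)), where ν_p denotes the p-adic valuation. -/

import Mathlib

/-- Let `a, b` be nonzero coprime integers with `a ≠ -b`, `n` a positive integer, and `p` an
odd prime with `p ∤ a * b` and `p ∣ (a^n + b^n)`. Then
`ν_p(a^n + b^n) - ν_p(n) = ν_p(a^(p-1) - b^(p-1))`. -/
theorem padicValInt_pow_add_pow (a b : ℤ) (ha : a ≠ 0) (hb : b ≠ 0) (hab : a ≠ -b)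
    (hcop : IsCoprime a b) (n : ℕ) (hn : 0 < n)
    (p : ℕ) (hp : p.Prime) (hp2 : p ≠ 2) (hpab : ¬ (p : ℤ) ∣ a * b)
    (hdvd : (p : ℤ) ∣ a ^ n + b ^ n) :
    (padicValInt p (a ^ n + b ^ n) : ℤ) - (padicValNat p n : ℤ) =
      (padicValInt p (a ^ (p - 1) - b ^ (p - 1)) : ℤ) := by
  have : Fact p.Prime := ⟨hp⟩
  have hP : Prime (p : ℤ) := Nat.prime_iff_prime_int.mp hp
  have hodd : Odd p := hp.odd_of_ne_two hp2
  have hpa : ¬ (p : ℤ) ∣ a := fun h => hpab (h.mul_right b)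
  have hpb : ¬ (p : ℤ) ∣ b := fun h => hpab (h.mul_left a)
  have hp_two : ¬ (p : ℤ) ∣ 2 := by
    intro h
    have h2 : p ∣ 2 := by exact_mod_cast h
    exact hp2 ((Nat.prime_dvd_prime_iff_eq hp Nat.prime_two).mp h2)
  have hdiff : ¬ (p : ℤ) ∣ a ^ n - b ^ n := by
    intro h
    have h1 : (p : ℤ) ∣ 2 * a ^ n := by
      have := dvd_add hdvd h
      have e : a ^ n + b ^ n + (a ^ n - b ^ n) = 2 * a ^ n := by ring
      rwa [e] at this
    rcases hP.dvd_or_dvd h1 with h1 | h1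
    · exact hp_two h1
    · exact hpa (hP.dvd_of_dvd_pow h1)
  have hne : a.natAbs ≠ b.natAbs := by
    intro h
    rcases Int.natAbs_eq_natAbs_iff.mp h with h | h
    · apply hdiff
      simp [h]
    · exact hab h
  have hpm : p - 1 ≠ 0 := by have := hp.two_le; omega
  have hnz : ∀ k : ℕ, k ≠ 0 → (a ^ k).natAbs ≠ (b ^ k).natAbs := by
    intro k hk h
    rw [Int.natAbs_pow, Int.natAbs_pow] at h
    exact hne (Nat.pow_left_injective hk h)
  have hA : a ^ n + b ^ n ≠ 0 := by
    intro h
    apply hnz n hn.ne'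
    rw [eq_neg_of_add_eq_zero_left h, Int.natAbs_neg]
  have hB : a ^ (p - 1) - b ^ (p - 1) ≠ 0 := by
    intro h
    apply hnz (p - 1) hpm
    rw [sub_eq_zero.mp h]
  have hferm : (p : ℤ) ∣ a ^ (p - 1) - b ^ (p - 1) := by
    rw [← ZMod.intCast_zmod_eq_zero_iff_dvd]
    rw [← ZMod.intCast_zmod_eq_zero_iff_dvd] at hpa hpb
    push_cast
    rw [ZMod.pow_card_sub_one_eq_one hpa, ZMod.pow_card_sub_one_eq_one hpb, sub_self]
  have e1 := Int.emultiplicity_pow_sub_pow hp hodd hferm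
    (fun h => hpa (hP.dvd_of_dvd_pow h)) (2 * n)
  have hfac : a ^ (2 * n) - b ^ (2 * n) = (a ^ n + b ^ n) * (a ^ n - b ^ n) := by ring
  have e2 := Int.emultiplicity_pow_sub_pow hp hodd
    (x := a ^ (2 * n)) (y := b ^ (2 * n)) (by rw [hfac]; exact hdvd.mul_right _)
    (fun h => hpa (hP.dvd_of_dvd_pow h)) (p - 1)
  have hpp : ¬ p ∣ p - 1 := by
    intro h
    have := Nat.le_of_dvd (Nat.pos_of_ne_zero hpm) h
    omega
  rw [hfac, emultiplicity_mul hP, emultiplicity_eq_zero.mpr hdiff,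
    emultiplicity_eq_zero.mpr hpp, add_zero, add_zero] at e2
  have hp_two_nat : ¬ p ∣ 2 := fun h => hp_two (by exact_mod_cast h)
  rw [emultiplicity_mul hp.prime, emultiplicity_eq_zero.mpr hp_two_nat,
    zero_add] at e1
  rw [pow_right_comm a, pow_right_comm b, e2] at e1
  have conv : ∀ z : ℤ, z ≠ 0 → emultiplicity (p : ℤ) z = (padicValInt p z : ℕ∞) := by
    intro z hz
    rw [padicValInt, padicValNat_eq_emultiplicity (Int.natAbs_ne_zero.mpr hz),
      Int.emultiplicity_natAbs]
  rw [conv _ hA, conv _ hB, ← padicValNat_eq_emultiplicity hn.ne'] at e1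
  have e3 : padicValInt p (a ^ n + b ^ n) =
      padicValInt p (a ^ (p - 1) - b ^ (p - 1)) + padicValNat p n := by exact_mod_cast e1
  omega
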